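/- arXiv:1412.1318 — 11 statements merged into one kernel-verified Lean document; each statement's English description precedes it below -/
import Mathlib

section
/- Let G = (V,E) be a finite simple undirected graph with an (α,β)-partition satisfying Invariant 1, and let V* = {v ∈ V : W_v ≥ 1}. Then V* is a vertex cover of G, i.e., every edge of E has at least one endpoint in V*. -/
open Finset

/-- The weight `W_v(i)` that node `v` would receive if it were placed at level `i`
in an `(α,β)`-partition with level function `ℓ`:
`W_v(i) = ∑_{u ∈ N_v} β^{-max(ℓ(u), i)}`.  The actual weight of `v` is `W_v = W_v(ℓ(v))`. -/
noncomputable def levelWeight {V : Type*} [Fintype V] [DecidableEq V]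
    (G : SimpleGraph V) [DecidableRel G.Adj] (ℓ : V → ℕ) (β : ℝ) (v : V) (i : ℕ) : ℝ :=
  ∑ u ∈ G.neighborFinset v, β ^ (-(max (ℓ u) i : ℤ))

/-- A node at level `0` with a neighbor at level `0` has weight at least `1`. -/
theorem one_le_levelWeight_of_adj {V : Type*} [Fintype V] [DecidableEq V]
    (G : SimpleGraph V) [DecidableRel G.Adj] (ℓ : V → ℕ) {β : ℝ} (hβ : 0 ≤ β) {u v : V}
    (h : G.Adj u v) (hv : ℓ v = 0) : 1 ≤ levelWeight G ℓ β u 0 := by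
  have hle := Finset.single_le_sum (f := fun x => β ^ (-(max (ℓ x) (0 : ℕ) : ℤ)))
    (fun x _ => zpow_nonneg hβ _) ((G.mem_neighborFinset u v).2 h)
  simpa [levelWeight, hv] using hle

/-- If the `(α,β)`-partition satisfies Invariant 1, then `V* = {v : W_v ≥ 1}`
is a vertex cover: every edge has an endpoint in `V*`. -/
theorem stmt_1 {V : Type*} [Fintype V] [DecidableEq V]
    (G : SimpleGraph V) [DecidableRel G.Adj]
    (α β : ℝ) (hα : 1 < α) (hβ : 1 < β)
    (L : ℕ) (hL : (L : ℤ) = ⌈Real.logb β ((Fintype.card V : ℝ) / α)⌉)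
    (ℓ : V → ℕ) (hℓ : ∀ v : V, ℓ v ≤ L)
    (hInv : ∀ v : V,
      (ℓ v = 0 → levelWeight G ℓ β v (ℓ v) ≤ α * β) ∧
      (1 ≤ ℓ v → 1 ≤ levelWeight G ℓ β v (ℓ v) ∧ levelWeight G ℓ β v (ℓ v) ≤ α * β)) :
    ∀ u v : V, G.Adj u v →
      u ∈ {x : V | 1 ≤ levelWeight G ℓ β x (ℓ x)} ∨
      v ∈ {x : V | 1 ≤ levelWeight G ℓ β x (ℓ x)} := by
  intro u v h
  rcases Nat.eq_zero_or_pos (ℓ u) with hu | hu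
  · rcases Nat.eq_zero_or_pos (ℓ v) with hv | hv
    · left
      rw [Set.mem_ofPred_eq, hu]
      exact one_le_levelWeight_of_adj G ℓ (by linarith) h hv
    · exact Or.inr ((hInv v).2 hv).1
  · exact Or.inl ((hInv u).2 hu).1
end

section
/- Let G = (V,E) be a finite simple undirected graph with an (α,β)-partition satisfying Invariant 1, and let V* = {v ∈ V : W_v ≥ 1}. Then for every vertex cover C of G, |V*| ≤ 2αβ · |C|. In particular, the size of V* is at most 2αβ times the size of a minimum vertex cover of G. -/
open Finset

/-- The weights of the nodes sum to at most twice their sum over a vertex cover. -/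
theorem sum_levelWeight_le_two_mul_sum_vertexCover {V : Type*} [Fintype V] [DecidableEq V]
    (G : SimpleGraph V) [DecidableRel G.Adj] (ℓ : V → ℕ) {β : ℝ} (hβ : 0 ≤ β)
    (C : Finset V) (hC : ∀ u v : V, G.Adj u v → u ∈ C ∨ v ∈ C) :
    ∑ v, levelWeight G ℓ β v (ℓ v) ≤ 2 * ∑ v ∈ C, levelWeight G ℓ β v (ℓ v) := by
  let w : V → V → ℝ := fun v u => if G.Adj v u then β ^ (-(max (ℓ u) (ℓ v) : ℤ)) else 0
  have hw : ∀ v, levelWeight G ℓ β v (ℓ v) = ∑ u, w v u := fun v => by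
    simp only [levelWeight, w, SimpleGraph.neighborFinset_eq_filter, sum_filter]
  have hw_symm : ∀ v u, w v u = w u v := fun v u => by
    simp only [w, G.adj_comm v u, max_comm]
  have hw_nonneg : ∀ v u, 0 ≤ w v u := fun v u => by
    simp only [w]
    split_ifs <;> positivity
  have hw_le : ∀ v u, w v u ≤ (if v ∈ C then w v u else 0) + (if u ∈ C then w v u else 0) := by
    intro v u
    have h := hw_nonneg v u
    by_cases hadj : G.Adj v u
    · rcases hC v u hadj with hv | hu
      · rw [if_pos hv]
        split_ifs <;> linarith
      · rw [if_pos hu]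
        split_ifs <;> linarith
    · simp [w, hadj]
  have h_left : ∑ v, ∑ u, (if v ∈ C then w v u else 0) = ∑ v ∈ C, ∑ u, w v u := by
    rw [← sum_subset (subset_univ C) fun v _ hv => by simp [hv]]
    exact sum_congr rfl fun v hv => by simp [hv]
  have h_right : ∑ v, ∑ u, (if u ∈ C then w v u else 0) = ∑ v ∈ C, ∑ u, w v u := by
    rw [sum_comm, ← h_left]
    exact sum_congr rfl fun v _ => sum_congr rfl fun u _ => by rw [hw_symm u v]
  simp only [hw]
  calc ∑ v, ∑ u, w v u
      ≤ ∑ v, ∑ u, ((if v ∈ C then w v u else 0) + (if u ∈ C then w v u else 0)) :=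
        sum_le_sum fun v _ => sum_le_sum fun u _ => hw_le v u
    _ = 2 * ∑ v ∈ C, ∑ u, w v u := by
        simp only [sum_add_distrib, h_left, h_right, two_mul]

/-- If the `(α,β)`-partition satisfies Invariant 1, then the set `V* = {v : W_v ≥ 1}`
has size at most `2αβ` times the size of any vertex cover `C` of `G`. -/
theorem stmt_2 {V : Type*} [Fintype V] [DecidableEq V]
    (G : SimpleGraph V) [DecidableRel G.Adj]
    (α β : ℝ) (hα : 1 < α) (hβ : 1 < β)
    (L : ℕ) (hL : (L : ℤ) = ⌈Real.logb β ((Fintype.card V : ℝ) / α)⌉)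
    (ℓ : V → ℕ) (hℓ : ∀ v : V, ℓ v ≤ L)
    (hInv : ∀ v : V,
      (ℓ v = 0 → levelWeight G ℓ β v (ℓ v) ≤ α * β) ∧
      (1 ≤ ℓ v → 1 ≤ levelWeight G ℓ β v (ℓ v) ∧ levelWeight G ℓ β v (ℓ v) ≤ α * β))
    (C : Finset V) (hC : ∀ u v : V, G.Adj u v → u ∈ C ∨ v ∈ C) :
    (({x : V | 1 ≤ levelWeight G ℓ β x (ℓ x)} : Set V).ncard : ℝ) ≤
      2 * α * β * (C.card : ℝ) := by
  have hnonneg : ∀ v, 0 ≤ levelWeight G ℓ β v (ℓ v) := fun v =>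
    sum_nonneg fun u _ => by positivity
  have hle : ∀ v, levelWeight G ℓ β v (ℓ v) ≤ α * β := fun v =>
    (Nat.eq_zero_or_pos (ℓ v)).elim (hInv v).1 fun h => ((hInv v).2 h).2
  classical
  have hset : {x : V | 1 ≤ levelWeight G ℓ β x (ℓ x)} =
      ↑({x | 1 ≤ levelWeight G ℓ β x (ℓ x)} : Finset V) := by
    ext x
    simp
  rw [hset, Set.ncard_coe_finset]
  calc ((({x | 1 ≤ levelWeight G ℓ β x (ℓ x)} : Finset V).card : ℕ) : ℝ)
      = ∑ x with 1 ≤ levelWeight G ℓ β x (ℓ x), (1 : ℝ) := by simp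
    _ ≤ ∑ x with 1 ≤ levelWeight G ℓ β x (ℓ x), levelWeight G ℓ β x (ℓ x) :=
        sum_le_sum fun x hx => (mem_filter.1 hx).2
    _ ≤ ∑ x, levelWeight G ℓ β x (ℓ x) :=
        sum_le_sum_of_subset_of_nonneg (subset_univ _) fun x _ _ => hnonneg x
    _ ≤ 2 * ∑ x ∈ C, levelWeight G ℓ β x (ℓ x) :=
        sum_levelWeight_le_two_mul_sum_vertexCover G ℓ (by linarith) C hC
    _ ≤ 2 * ∑ _x ∈ C, α * β := by
        gcongr
        exact hle _
    _ = 2 * α * β * (C.card : ℝ) := by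
        rw [sum_const, nsmul_eq_mul]
        ring
end

section
/- Let G = (V,E) be a finite simple undirected graph with an (α,β)-partition satisfying Invariant 1. Define x(u,v) = w(u,v)/(αβ) for each edge (u,v) ∈ E. Then x is a valid fractional matching in G (i.e., x(e) ∈ [0,1] for every edge e, and ∑_{u∈N_v} x(u,v) ≤ 1 for every node v), and the set V* = {v ∈ V : W_v ≥ 1} satisfies |V*| ≤ 2αβ · ∑_{(u,v)∈E} x(u,v). -/
open Finset

/-- The weighted degree-sum formula: summing an edge weight over the neighbourhoods of all
vertices counts every edge twice. -/
theorem SimpleGraph.sum_sum_neighborFinset_eq_two_nsmul_sum_edgeFinset {V M : Type*} [Fintype V]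
    [DecidableEq V] [AddCommMonoid M] (G : SimpleGraph V) [DecidableRel G.Adj] (f : Sym2 V → M) :
    ∑ v, ∑ u ∈ G.neighborFinset v, f s(u, v) = 2 • ∑ e ∈ G.edgeFinset, f e := by
  trans ∑ d : G.Dart, f d.edge
  · rw [← Finset.sum_fiberwise (s := Finset.univ) (g := fun d : G.Dart => d.fst)]
    refine Finset.sum_congr rfl fun v _ => ?_
    rw [G.dart_fst_fiber, Finset.sum_image (G.dartOfNeighborSet_injective v).injOn,
      Finset.sum_subtype _ (p := (· ∈ G.neighborSet v)) (fun u => G.mem_neighborFinset v u)]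
    exact Finset.sum_congr rfl fun u _ => congrArg f Sym2.eq_swap
  · rw [← Finset.sum_fiberwise_of_maps_to (t := G.edgeFinset) (g := fun d : G.Dart => d.edge)
        fun d _ => G.mem_edgeFinset.2 d.edge_mem, Finset.smul_sum]
    refine Finset.sum_congr rfl fun e he => ?_
    rw [← G.dart_edge_fiber_card e (G.mem_edgeFinset.1 he), ← Finset.sum_const]
    exact Finset.sum_congr rfl fun d hd => congrArg f (Finset.mem_filter.1 hd).2

/-- Setting `x(u,v) = w(u,v)/(αβ)` on every edge gives a valid fractional matching,
and `|V*| ≤ 2αβ · ∑_{(u,v) ∈ E} x(u,v)` where `V* = {v : W_v ≥ 1}`. -/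
theorem stmt_3 {V : Type*} [Fintype V] [DecidableEq V]
    (G : SimpleGraph V) [DecidableRel G.Adj]
    (α β : ℝ) (hα : 1 < α) (hβ : 1 < β)
    (L : ℕ) (hL : (L : ℤ) = ⌈Real.logb β ((Fintype.card V : ℝ) / α)⌉)
    (ℓ : V → ℕ) (hℓ : ∀ v : V, ℓ v ≤ L)
    (hInv : ∀ v : V,
      (ℓ v = 0 → levelWeight G ℓ β v (ℓ v) ≤ α * β) ∧
      (1 ≤ ℓ v → 1 ≤ levelWeight G ℓ β v (ℓ v) ∧ levelWeight G ℓ β v (ℓ v) ≤ α * β)) :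
    (∀ u v : V, G.Adj u v →
        0 ≤ β ^ (-(max (ℓ u) (ℓ v) : ℤ)) / (α * β) ∧
        β ^ (-(max (ℓ u) (ℓ v) : ℤ)) / (α * β) ≤ 1) ∧
    (∀ v : V, ∑ u ∈ G.neighborFinset v, β ^ (-(max (ℓ u) (ℓ v) : ℤ)) / (α * β) ≤ 1) ∧
    (({x : V | 1 ≤ levelWeight G ℓ β x (ℓ x)} : Set V).ncard : ℝ) ≤
      2 * α * β *
        ∑ e ∈ G.edgeFinset,
          Sym2.lift
            ⟨fun u v => β ^ (-(max (ℓ u) (ℓ v) : ℤ)) / (α * β),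
             fun u v => by simp only [max_comm]⟩ e := by
  have hαβ : 1 < α * β := one_lt_mul hα.le hβ
  have hpos : 0 < α * β := one_pos.trans hαβ
  have hW : ∀ v, levelWeight G ℓ β v (ℓ v) ≤ α * β := fun v =>
    (Nat.eq_zero_or_pos (ℓ v)).elim (hInv v).1 fun h => ((hInv v).2 h).2
  have hW0 : ∀ v, 0 ≤ levelWeight G ℓ β v (ℓ v) := fun v =>
    Finset.sum_nonneg fun u _ => by positivity
  have hsum : ∀ v, ∑ u ∈ G.neighborFinset v, β ^ (-(max (ℓ u) (ℓ v) : ℤ)) / (α * β) =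
      levelWeight G ℓ β v (ℓ v) / (α * β) := fun v => (Finset.sum_div _ _ _).symm
  refine ⟨fun u v _ => ⟨by positivity, ?_⟩, fun v => ?_, ?_⟩
  · rw [div_le_one hpos]
    exact (zpow_le_one_of_nonpos₀ hβ.le (by omega)).trans hαβ.le
  · rw [hsum, div_le_one hpos]
    exact hW v
  · have hcount := G.sum_sum_neighborFinset_eq_two_nsmul_sum_edgeFinset
      (Sym2.lift ⟨fun u v => β ^ (-(max (ℓ u) (ℓ v) : ℤ)) / (α * β),
        fun u v => by simp only [max_comm]⟩)
    simp only [Sym2.lift_mk, hsum, ← Finset.sum_div, nsmul_eq_mul, Nat.cast_ofNat] at hcount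
    calc (({x : V | 1 ≤ levelWeight G ℓ β x (ℓ x)} : Set V).ncard : ℝ)
        = ∑ v with 1 ≤ levelWeight G ℓ β v (ℓ v), (1 : ℝ) := by
          rw [← Finset.coe_filter_univ, Set.ncard_coe_finset, Finset.sum_const, nsmul_one]
      _ ≤ ∑ v with 1 ≤ levelWeight G ℓ β v (ℓ v), levelWeight G ℓ β v (ℓ v) :=
          Finset.sum_le_sum fun v hv => (Finset.mem_filter.1 hv).2
      _ ≤ ∑ v, levelWeight G ℓ β v (ℓ v) :=
          Finset.sum_le_sum_of_subset_of_nonneg (Finset.filter_subset _ _) fun v _ _ => hW0 v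
      _ = α * β * ((∑ v, levelWeight G ℓ β v (ℓ v)) / (α * β)) :=
          (mul_div_cancel₀ _ hpos.ne').symm
      _ = _ := by rw [hcount]; ring
end

section
/- Let κ(G) be an (ε,c)-kernel of a finite simple undirected graph G = (V,E) with c ≥ 1 and ε ∈ [0,1/3), and let M be a maximal matching in κ(G). Then M is a (4+6ε)-approximation to the maximum matching in G: for every matching M° in G, |M°| ≤ (4+6ε) · |M|. -/
/-- `M` is a matching in the graph `H`: a set of edges of `H` that are pairwise
vertex-disjoint. -/
def IsMatchingOn {V : Type*} (H : SimpleGraph V) (M : Finset (Sym2 V)) : Prop :=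
  (∀ e ∈ M, e ∈ H.edgeSet) ∧
  (∀ e ∈ M, ∀ f ∈ M, e ≠ f → ∀ v : V, v ∈ e → v ∉ f)

/-- A vertex `v` is matched in the matching `M` if some edge of `M` is incident to it. -/
def Matched {V : Type*} (M : Finset (Sym2 V)) (v : V) : Prop :=
  ∃ e ∈ M, v ∈ e

/-- `K` (with tight-node set `T`) is an `(ε,c)`-kernel of `G`:
`K` is a subgraph of `G`, every node has at most `(1+ε)c` neighbors in `K`
(its "friends"), every tight node has at least `(1-ε)c` friends, and every edge of `G`
joining two slack (i.e. non-tight) nodes belongs to `K`. -/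
def IsKernel {V : Type*} (G K : SimpleGraph V) (T : Set V) (ε c : ℝ) : Prop :=
  K ≤ G ∧
  (∀ v : V, ((K.neighborSet v).ncard : ℝ) ≤ (1 + ε) * c) ∧
  (∀ v ∈ T, (1 - ε) * c ≤ ((K.neighborSet v).ncard : ℝ)) ∧
  (∀ u v : V, G.Adj u v → u ∉ T → v ∉ T → K.Adj u v)

/-- `p 0, p 1, …, p (2k+1)` is an augmenting path of length `2k+1` in the graph `H`
with respect to the matching `M`: the vertices are distinct, consecutive vertices are
adjacent in `H`, the edges alternate between edges outside `M` (for even edge index)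
and edges of `M` (for odd edge index) — so the path starts and ends with edges outside
`M` — and both endpoints are unmatched in `M`. -/
def IsAugPath {V : Type*} (H : SimpleGraph V) (M : Finset (Sym2 V)) (k : ℕ)
    (p : ℕ → V) : Prop :=
  (∀ i j, i ≤ 2 * k + 1 → j ≤ 2 * k + 1 → p i = p j → i = j) ∧
  (∀ i, i ≤ 2 * k → H.Adj (p i) (p (i + 1))) ∧
  (∀ i, i ≤ 2 * k → (s(p i, p (i + 1)) ∈ M ↔ Odd i)) ∧
  ¬ Matched M (p 0) ∧ ¬ Matched M (p (2 * k + 1))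

/-- A matching whose edges all meet `S` has at most `S.card` edges. -/
theorem IsMatchingOn.card_le_of_cover {V : Type*} {H : SimpleGraph V} {M : Finset (Sym2 V)}
    (hM : IsMatchingOn H M) (S : Finset V) (hS : ∀ e ∈ M, ∃ v ∈ S, v ∈ e) :
    M.card ≤ S.card := by
  classical
  have hS' : ∀ e : M, ∃ v : S, v.1 ∈ e.1 := fun e =>
    let ⟨v, hv, hve⟩ := hS e.1 e.2
    ⟨⟨v, hv⟩, hve⟩
  choose f hf using hS'
  rw [← Fintype.card_coe M, ← Fintype.card_coe S]
  refine Fintype.card_le_of_injective f fun e e' h => ?_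
  by_contra hne
  exact hM.2 e e.2 e' e'.2 (fun h' => hne (Subtype.ext h')) (f e) (hf e) (h ▸ hf e')

open Classical in
/-- A set `M` of edges matches at most `2 * M.card` vertices. -/
theorem card_matched_le {V : Type*} [Fintype V] (M : Finset (Sym2 V)) :
    (Finset.univ.filter (Matched M)).card ≤ 2 * M.card := by
  have h : Finset.univ.filter (Matched M) = M.biUnion Sym2.toFinset := by
    ext v
    simp [Matched]
  rw [h, mul_comm]
  refine Finset.card_biUnion_le_card_mul _ _ _ fun e _ => ?_
  by_cases he : e.IsDiag
  · simp [Sym2.card_toFinset, he]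
  · simp [Sym2.card_toFinset, he]

open Classical in
/-- If all neighbors of vertices of `F` lie in `A`, vertices of `F` have degree at least `l`
and vertices of `A` have degree at most `u`, then `l * |F| ≤ u * |A|`. -/
theorem mul_card_le_mul_card_of_neighborSet {V : Type*} [Fintype V] (K : SimpleGraph V)
    (F A : Finset V) (l u : ℝ) (hFA : ∀ v ∈ F, ∀ w, K.Adj v w → w ∈ A)
    (hl : ∀ v ∈ F, l ≤ ((K.neighborSet v).ncard : ℝ))
    (hu : ∀ v ∈ A, ((K.neighborSet v).ncard : ℝ) ≤ u) :
    l * (F.card : ℝ) ≤ u * (A.card : ℝ) := by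
  have hcount := Finset.sum_card_bipartiteAbove_eq_sum_card_bipartiteBelow (s := F) (t := A) K.Adj
  have h1 : l * (F.card : ℝ) ≤ ∑ v ∈ F, ((A.bipartiteAbove K.Adj v).card : ℝ) := by
    rw [mul_comm, ← nsmul_eq_mul]
    refine Finset.card_nsmul_le_sum _ _ _ fun v hv => (hl v hv).trans ?_
    have hsub : K.neighborSet v ⊆ (A.bipartiteAbove K.Adj v : Set V) := fun w hw =>
      Finset.mem_coe.2 ((Finset.mem_bipartiteAbove _).2 ⟨hFA v hv w hw, hw⟩)
    rw [← Set.ncard_coe_finset]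
    exact_mod_cast Set.ncard_le_ncard hsub (Set.toFinite _)
  have h2 : ∑ v ∈ A, ((F.bipartiteBelow K.Adj v).card : ℝ) ≤ u * (A.card : ℝ) := by
    rw [mul_comm, ← nsmul_eq_mul]
    refine Finset.sum_le_card_nsmul _ _ _ fun v hv => le_trans ?_ (hu v hv)
    have hsub : (F.bipartiteBelow K.Adj v : Set V) ⊆ K.neighborSet v := fun w hw =>
      ((Finset.mem_bipartiteBelow _).1 (Finset.mem_coe.1 hw)).2.symm
    rw [← Set.ncard_coe_finset]
    exact_mod_cast Set.ncard_le_ncard hsub (Set.toFinite _)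
  refine h1.trans (le_trans (le_of_eq ?_) h2)
  exact_mod_cast hcount

/-- If `M` is a maximal matching in an `(ε,c)`-kernel `K` of `G` (with `c ≥ 1`,
`0 ≤ ε < 1/3`), then `M` is a `(4+6ε)`-approximate maximum matching of `G`. -/
theorem stmt_7 {V : Type*} [Fintype V] (G K : SimpleGraph V) (T : Set V)
    (ε c : ℝ) (hc : 1 ≤ c) (hε0 : 0 ≤ ε) (hε : ε < 1 / 3)
    (hker : IsKernel G K T ε c)
    (M : Finset (Sym2 V)) (hM : IsMatchingOn K M)
    (hmax : ∀ u v : V, K.Adj u v → Matched M u ∨ Matched M v)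
    (M' : Finset (Sym2 V)) (hM' : IsMatchingOn G M') :
    (M'.card : ℝ) ≤ (4 + 6 * ε) * (M.card : ℝ) := by
  classical
  obtain ⟨-, hup, hlow, hslack⟩ := hker
  set A : Finset V := Finset.univ.filter (Matched M) with hA
  set F : Finset V := Finset.univ.filter fun v => v ∈ T ∧ ¬ Matched M v with hF
  have hAcard : (A.card : ℝ) ≤ 2 * M.card := by exact_mod_cast card_matched_le M
  have hFcard : (1 - ε) * c * (F.card : ℝ) ≤ (1 + ε) * c * (A.card : ℝ) := by
    refine mul_card_le_mul_card_of_neighborSet K F A _ _ (fun v hv w hvw => ?_)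
      (fun v hv => hlow v (by simp [hF] at hv; exact hv.1)) fun v _ => hup v
    have hv' : ¬ Matched M v := by simp [hF] at hv; exact hv.2
    simpa [hA] using (hmax v w hvw).resolve_left hv'
  have hcover : ∀ e ∈ M', ∃ v ∈ A ∪ F, v ∈ e := by
    intro e he
    have hadj := hM'.1 e he
    induction e using Sym2.ind with
    | _ x y =>
      by_contra! hno
      have hx := hno x
      have hy := hno y
      simp only [hA, hF, Finset.mem_union, Finset.mem_filter, Finset.mem_univ, true_and,
        Sym2.mem_iff, true_or, or_true, not_true_eq_false, imp_false] at hx hy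
      have hK := hmax x y (hslack x y hadj (by tauto) (by tauto))
      tauto
  have hcard : (M'.card : ℝ) ≤ A.card + F.card := by
    exact_mod_cast (hM'.card_le_of_cover _ hcover).trans (Finset.card_union_le A F)
  have hF' : (1 - ε) * (F.card : ℝ) ≤ (1 + ε) * A.card :=
    le_of_mul_le_mul_left (by linarith) (show 0 < c by linarith)
  have hM0 : (0 : ℝ) ≤ M.card := Nat.cast_nonneg _
  have hε1 : 0 < 1 - ε := by linarith
  have hbound : (1 - ε) * (M'.card : ℝ) ≤ 4 * M.card := by
    nlinarith [mul_le_mul_of_nonneg_left hcard hε1.le]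
  have hconst : 4 ≤ (1 - ε) * (4 + 6 * ε) := by nlinarith
  refine le_of_mul_le_mul_left ?_ hε1
  calc (1 - ε) * (M'.card : ℝ) ≤ 4 * M.card := hbound
    _ ≤ (1 - ε) * (4 + 6 * ε) * M.card := mul_le_mul_of_nonneg_right hconst hM0
    _ = (1 - ε) * ((4 + 6 * ε) * M.card) := by ring
end

section
/- Let κ(G) be an (ε,c)-kernel of a finite simple undirected graph G = (V,E) with c ≥ 1 and ε ∈ [0,1/3), let M be a maximal matching in κ(G), and let F_T denote the set of tight nodes that are unmatched (free) in M. Then |F_T| ≤ (2+6ε) · |M|. -/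
/-- A finite set of edges covers at most twice as many vertices as it has edges. -/
theorem card_filter_matched_le {V : Type*} [Fintype V] (M : Finset (Sym2 V))
    [DecidablePred (Matched M)] :
    (Finset.univ.filter (Matched M)).card ≤ 2 * M.card := by
  classical
  have hsub : Finset.univ.filter (Matched M) ⊆ M.biUnion Sym2.toFinset := by
    intro v hv
    simpa [Matched] using hv
  calc (Finset.univ.filter (Matched M)).card
      ≤ (M.biUnion Sym2.toFinset).card := Finset.card_le_card hsub
    _ ≤ M.card * 2 := Finset.card_biUnion_le_card_mul _ _ _ fun e _ => by
        rw [Sym2.card_toFinset]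
        split_ifs <;> omega
    _ = 2 * M.card := Nat.mul_comm _ _

/-- If all neighbors of vertices of `S` lie in `W`, every vertex of `S` has degree at least `a`
and every vertex of `W` has degree at most `b`, then `|S| a ≤ |W| b`. -/
theorem card_mul_le_card_mul_of_neighborSet_subset {V : Type*} [Finite V] (K : SimpleGraph V)
    (S W : Finset V) (a b : ℝ) (hSW : ∀ v ∈ S, ∀ w, K.Adj v w → w ∈ W)
    (ha : ∀ v ∈ S, a ≤ ((K.neighborSet v).ncard : ℝ))
    (hb : ∀ w ∈ W, ((K.neighborSet w).ncard : ℝ) ≤ b) :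
    (S.card : ℝ) * a ≤ W.card * b := by
  classical
  have h_above : ∀ v ∈ S, (K.neighborSet v).ncard = (W.bipartiteAbove K.Adj v).card := by
    intro v hv
    rw [← Set.ncard_coe_finset]
    congr 1
    ext w
    simpa using hSW v hv w
  have h_below : ∀ w, (S.bipartiteBelow K.Adj w).card ≤ (K.neighborSet w).ncard := by
    intro w
    rw [← Set.ncard_coe_finset]
    refine Set.ncard_le_ncard (fun v hv => ?_) (Set.toFinite _)
    simp only [Finset.mem_coe, Finset.mem_bipartiteBelow] at hv
    exact hv.2.symm
  have h_count := Finset.sum_card_bipartiteAbove_eq_sum_card_bipartiteBelow (s := S) (t := W) K.Adj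
  calc (S.card : ℝ) * a = ∑ _v ∈ S, a := by simp
    _ ≤ ∑ v ∈ S, ((W.bipartiteAbove K.Adj v).card : ℝ) :=
        Finset.sum_le_sum fun v hv => h_above v hv ▸ ha v hv
    _ = ∑ w ∈ W, ((S.bipartiteBelow K.Adj w).card : ℝ) := mod_cast h_count
    _ ≤ ∑ _w ∈ W, b :=
        Finset.sum_le_sum fun w hw => (Nat.cast_le.mpr (h_below w)).trans (hb w hw)
    _ = W.card * b := by simp

/-- If `M` is a maximal matching in an `(ε,c)`-kernel `K` of `G` (with `c ≥ 1`,
`0 ≤ ε < 1/3`), then the set `F_T` of tight nodes left unmatched by `M` satisfies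
`|F_T| ≤ (2+6ε)·|M|`. -/
theorem stmt_8 {V : Type*} [Fintype V] (G K : SimpleGraph V) (T : Set V)
    (ε c : ℝ) (hc : 1 ≤ c) (hε0 : 0 ≤ ε) (hε : ε < 1 / 3)
    (hker : IsKernel G K T ε c)
    (M : Finset (Sym2 V)) (hM : IsMatchingOn K M)
    (hmax : ∀ u v : V, K.Adj u v → Matched M u ∨ Matched M v) :
    (({v : V | v ∈ T ∧ ¬ Matched M v} : Set V).ncard : ℝ) ≤ (2 + 6 * ε) * (M.card : ℝ) := by
  classical
  obtain ⟨-, hub, hlb, -⟩ := hker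
  set F := Finset.univ.filter fun v => v ∈ T ∧ ¬ Matched M v with hF
  have hFcard : ({v : V | v ∈ T ∧ ¬ Matched M v} : Set V).ncard = F.card := by
    rw [← Set.ncard_coe_finset, hF, Finset.coe_filter_univ]
  have h_count := card_mul_le_card_mul_of_neighborSet_subset K F (Finset.univ.filter (Matched M))
    ((1 - ε) * c) ((1 + ε) * c)
    (fun v hv w hvw => by
      simp only [hF, Finset.mem_filter, Finset.mem_univ, true_and] at hv ⊢
      exact (hmax v w hvw).resolve_left hv.2)
    (fun v hv => hlb v (by simp_all)) (fun w _ => hub w)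
  have hW : ((Finset.univ.filter (Matched M)).card : ℝ) ≤ 2 * M.card :=
    mod_cast card_filter_matched_le M
  have h_ratio : 1 + ε ≤ (1 + 3 * ε) * (1 - ε) := by nlinarith
  have hpos : 0 < (1 - ε) * c := mul_pos (by linarith) (by linarith)
  rw [hFcard]
  refine le_of_mul_le_mul_right ?_ hpos
  calc (F.card : ℝ) * ((1 - ε) * c)
      ≤ (Finset.univ.filter (Matched M)).card * ((1 + ε) * c) := h_count
    _ ≤ 2 * M.card * (((1 + 3 * ε) * (1 - ε)) * c) := by gcongr
    _ = (2 + 6 * ε) * M.card * ((1 - ε) * c) := by ring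
end

section
/- Let κ(G) be an (ε,c)-kernel of a finite simple undirected graph G = (V,E) with c ≥ 1 and ε ∈ [0,1/3), and let M be a matching in κ(G) that is maximal in κ(G). Then every edge (u,v) ∈ E such that both u and v are unmatched in M has at least one endpoint that is a tight node; in particular, for every matching M° of G, the number of edges of M° whose both endpoints are unmatched in M is at most |F_T|, the number of tight nodes unmatched in M. -/
/-- If `M` is a maximal matching in an `(ε,c)`-kernel `K` of `G`, then every edge of `G`
with both endpoints unmatched in `M` has a tight endpoint; consequently, for every
matching `M°` of `G`, the number of edges of `M°` whose both endpoints are unmatched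
in `M` is at most `|F_T|`, the number of tight nodes unmatched in `M`. -/
theorem stmt_9 {V : Type*} [Fintype V] (G K : SimpleGraph V) (T : Set V)
    (ε c : ℝ) (hc : 1 ≤ c) (hε0 : 0 ≤ ε) (hε : ε < 1 / 3)
    (hker : IsKernel G K T ε c)
    (M : Finset (Sym2 V)) (hM : IsMatchingOn K M)
    (hmax : ∀ u v : V, K.Adj u v → Matched M u ∨ Matched M v) :
    (∀ u v : V, G.Adj u v → ¬ Matched M u → ¬ Matched M v → u ∈ T ∨ v ∈ T) ∧
    (∀ Mo : Finset (Sym2 V), IsMatchingOn G Mo →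
      ({e : Sym2 V | e ∈ Mo ∧ ∀ v ∈ e, ¬ Matched M v} : Set (Sym2 V)).ncard ≤
        ({v : V | v ∈ T ∧ ¬ Matched M v} : Set V).ncard) := by
  obtain ⟨-, -, -, hslack⟩ := hker
  have htight : ∀ u v : V, G.Adj u v → ¬ Matched M u → ¬ Matched M v → u ∈ T ∨ v ∈ T := by
    intro u v huv hu hv
    by_contra! h
    exact (hmax u v (hslack u v huv h.1 h.2)).elim hu hv
  refine ⟨htight, fun Mo hMo => ?_⟩
  have htightEnd : ∀ e : Sym2 V, ∃ v ∈ e,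
      (e ∈ Mo ∧ ∀ w ∈ e, ¬ Matched M w) → v ∈ T ∧ ¬ Matched M v := by
    intro e
    induction e using Sym2.ind with
    | _ u v =>
      by_cases hu : u ∈ T
      · exact ⟨u, Sym2.mem_mk_left u v, fun h => ⟨hu, h.2 u (Sym2.mem_mk_left u v)⟩⟩
      · refine ⟨v, Sym2.mem_mk_right u v, fun h => ?_⟩
        have hv := h.2 v (Sym2.mem_mk_right u v)
        exact ⟨(htight u v (hMo.1 _ h.1) (h.2 u (Sym2.mem_mk_left u v)) hv).resolve_left hu, hv⟩
  choose f hf_mem hf_tight using htightEnd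
  refine Set.ncard_le_ncard_of_injOn f hf_tight ?_ (Set.toFinite _)
  intro e he e' he' hee'
  by_contra hne
  exact hMo.2 e he.1 e' he'.1 hne (f e) (hf_mem e) (hee' ▸ hf_mem e')
end

section
/- Let κ(G) be an (ε,c)-kernel of a finite simple undirected graph G = (V,E) with c ≥ 1 and ε ∈ [0,1/3), and let M be a matching in κ(G) such that every augmenting path in κ(G) with respect to M has length at least five. Let F_T denote the set of tight nodes unmatched in M. Then for every edge (u,v) ∈ M, the set (κ(N_u) ∩ F_T) ∪ (κ(N_v) ∩ F_T) has size at most (1+ε)c. -/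
/-- Distinct unmatched neighbours `x` of `u` and `y` of `v`, for an edge `uv` of the matching,
give the augmenting path `x, u, v, y` of length three. -/
theorem isAugPath_one_of_adj {V : Type*} {H : SimpleGraph V} {M : Finset (Sym2 V)} {u v x y : V}
    (huv : s(u, v) ∈ M) (huv' : H.Adj u v) (hx : H.Adj u x) (hy : H.Adj v y) (hxy : x ≠ y)
    (hxM : ¬ Matched M x) (hyM : ¬ Matched M y) :
    ∃ p : ℕ → V, IsAugPath H M 1 p := by
  have hu : Matched M u := ⟨_, huv, Sym2.mem_mk_left u v⟩
  have hv : Matched M v := ⟨_, huv, Sym2.mem_mk_right u v⟩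
  have hxu : x ≠ u := by rintro rfl; exact hxM hu
  have hxv : x ≠ v := by rintro rfl; exact hxM hv
  have hyu : y ≠ u := by rintro rfl; exact hyM hu
  have hyv : y ≠ v := by rintro rfl; exact hyM hv
  have h_first : s(x, u) ∉ M := fun h => hxM ⟨_, h, Sym2.mem_mk_left x u⟩
  have h_last : s(v, y) ∉ M := fun h => hyM ⟨_, h, Sym2.mem_mk_right v y⟩
  refine ⟨fun i => match i with | 0 => x | 1 => u | 2 => v | _ => y, ?_, ?_, ?_, hxM, hyM⟩
  · intro i j hi hj hij
    have := huv'.ne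
    interval_cases i <;> interval_cases j <;> simp_all
  · intro i hi
    interval_cases i
    exacts [hx.symm, huv', hy]
  · intro i hi
    interval_cases i
    · simpa using h_first
    · simpa using huv
    · simpa [Nat.odd_iff] using h_last

/-- Let `M` be a matching in an `(ε,c)`-kernel `K` of `G` such that every augmenting
path in `K` with respect to `M` has length at least five.  Then for every edge
`(u,v) ∈ M`, the set `(κ(N_u) ∩ F_T) ∪ (κ(N_v) ∩ F_T)` has size at most `(1+ε)c`,
where `F_T` is the set of tight nodes unmatched in `M`. -/
theorem stmt_10 {V : Type*} [Fintype V] (G K : SimpleGraph V) (T : Set V)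
    (ε c : ℝ) (hc : 1 ≤ c) (hε0 : 0 ≤ ε) (hε : ε < 1 / 3)
    (hker : IsKernel G K T ε c)
    (M : Finset (Sym2 V)) (hM : IsMatchingOn K M)
    (hAug : ∀ (k : ℕ) (p : ℕ → V), IsAugPath K M k p → 5 ≤ 2 * k + 1)
    (u v : V) (huv : s(u, v) ∈ M) :
    ((((K.neighborSet u ∩ {x : V | x ∈ T ∧ ¬ Matched M x}) ∪
        (K.neighborSet v ∩ {x : V | x ∈ T ∧ ¬ Matched M x})).ncard : ℝ)) ≤ (1 + ε) * c := by
  obtain ⟨-, hdeg, -, -⟩ := hker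
  have bound (w : V) {S : Set V} (hS : S ⊆ K.neighborSet w) : (S.ncard : ℝ) ≤ (1 + ε) * c :=
    le_trans (by exact_mod_cast Set.ncard_le_ncard hS (Set.toFinite _)) (hdeg w)
  set F : Set V := {x : V | x ∈ T ∧ ¬ Matched M x}
  by_cases hsub : K.neighborSet v ∩ F ⊆ K.neighborSet u ∩ F
  · exact bound u (Set.union_subset Set.inter_subset_left (hsub.trans Set.inter_subset_left))
  · obtain ⟨y, ⟨hy, hyF⟩, hyu⟩ := Set.not_subset.mp hsub
    refine bound v (Set.union_subset (fun x hx => ?_) Set.inter_subset_left)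
    have hxy : x ≠ y := by rintro rfl; exact hyu hx
    obtain ⟨p, hp⟩ := isAugPath_one_of_adj huv (hM.1 _ huv) hx.1 hy hxy hx.2.2 hyF.2
    have := hAug 1 p hp
    omega
end

section
/- Let κ(G) be an (ε,c)-kernel of a finite simple undirected graph G = (V,E) with c ≥ 1 and ε ∈ [0,1/3), and let M be a matching in κ(G) such that every augmenting path in κ(G) with respect to M has length at least five. Let F_T denote the set of tight nodes unmatched in M. Then |F_T| ≤ (1+3ε) · |M|. -/
/-- Neighbors of unmatched vertices are matched when there is no augmenting path of length one. -/
theorem matched_of_adj_of_not_matched {V : Type*} {K : SimpleGraph V} {M : Finset (Sym2 V)}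
    (hAug : ∀ p : ℕ → V, ¬ IsAugPath K M 0 p) {x u : V}
    (hx : ¬ Matched M x) (hxu : K.Adj x u) : Matched M u := by
  by_contra hu
  refine hAug (fun i => if i = 0 then x else u) ⟨?_, ?_, ?_, ?_, ?_⟩
  · intro i j hi hj hij
    have := hxu.ne
    have := hxu.ne'
    interval_cases i <;> interval_cases j <;> simp_all
  · intro i hi
    obtain rfl : i = 0 := by omega
    simpa using hxu
  · intro i hi
    obtain rfl : i = 0 := by omega
    simpa using fun h => hx ⟨_, h, Sym2.mem_mk_left x u⟩
  · simpa using hx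
  · simpa using hu

/-- Without augmenting paths of length three, the unmatched neighbors of the two ends of a
matching edge coincide. -/
theorem eq_of_adj_ends_of_not_matched {V : Type*} {K : SimpleGraph V} {M : Finset (Sym2 V)}
    (hM : IsMatchingOn K M) (hAug : ∀ p : ℕ → V, ¬ IsAugPath K M 1 p) {x u v y : V}
    (huv : s(u, v) ∈ M) (hx : ¬ Matched M x) (hy : ¬ Matched M y)
    (hux : K.Adj u x) (hvy : K.Adj v y) : x = y := by
  by_contra hxy
  have hadj : K.Adj u v := hM.1 _ huv
  have hne : ∀ {a b : V}, ¬ Matched M a → b ∈ s(u, v) → a ≠ b := by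
    rintro a b ha hb rfl
    exact ha ⟨_, huv, hb⟩
  have hxu : x ≠ u := hne hx (by simp)
  have hxv : x ≠ v := hne hx (by simp)
  have hyu : y ≠ u := hne hy (by simp)
  have hyv : y ≠ v := hne hy (by simp)
  have hxM : s(x, u) ∉ M := fun h => hx ⟨_, h, by simp⟩
  have hyM : s(v, y) ∉ M := fun h => hy ⟨_, h, by simp⟩
  refine hAug (fun i => if i = 0 then x else if i = 1 then u else if i = 2 then v else y)
    ⟨?_, ?_, ?_, ?_, ?_⟩
  · intro i j hi hj hij
    have := hadj.ne
    interval_cases i <;> interval_cases j <;> simp_all [eq_comm]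
  · intro i hi
    interval_cases i
    · simpa using hux.symm
    · simpa using hadj
    · simpa using hvy
  · intro i hi
    interval_cases i
    · simpa using hxM
    · simpa using huv
    · simpa [Nat.odd_iff] using hyM
  · simpa using hx
  · simpa using hy

open Classical in
/-- If no augmenting path has length one or three, the unmatched vertices have total degree at
most `d` times the size of the matching, where `d` bounds all degrees. -/
theorem sum_degree_le_card_mul {V : Type*} [Fintype V] {K : SimpleGraph V}
    {M : Finset (Sym2 V)} (hM : IsMatchingOn K M)
    (hAug₀ : ∀ p : ℕ → V, ¬ IsAugPath K M 0 p) (hAug₁ : ∀ p : ℕ → V, ¬ IsAugPath K M 1 p)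
    {d : ℕ} (hd : ∀ v, K.degree v ≤ d) {F : Finset V} (hF : ∀ x ∈ F, ¬ Matched M x) :
    ∑ x ∈ F, K.degree x ≤ M.card * d := by
  have hends : ∀ u v, s(u, v) ∈ M →
      (F.filter (K.Adj u)).card + (F.filter (K.Adj v)).card ≤ d := by
    intro u v huv
    have hsub : ∀ w, (F.filter (K.Adj w)).card ≤ d := fun w =>
      (Finset.card_le_card fun x hx => by simp_all).trans (hd w)
    rcases (F.filter (K.Adj u)).eq_empty_or_nonempty with hu | ⟨x, hx⟩
    · simpa [hu] using hsub v
    rcases (F.filter (K.Adj v)).eq_empty_or_nonempty with hv | ⟨y, hy⟩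
    · simpa [hv] using hsub u
    rw [Finset.mem_filter] at hx hy
    have heq : ∀ a b, a ∈ F → b ∈ F → K.Adj u a → K.Adj v b → a = b := fun a b ha hb =>
      eq_of_adj_ends_of_not_matched hM hAug₁ huv (hF a ha) (hF b hb)
    have hu1 : (F.filter (K.Adj u)).card ≤ 1 :=
      Finset.card_le_card (t := {y}) (fun a ha => by
        rw [Finset.mem_filter] at ha
        simpa using heq a y ha.1 hy.1 ha.2 hy.2)
    have hv1 : (F.filter (K.Adj v)).card ≤ 1 :=
      Finset.card_le_card (t := {x}) (fun b hb => by
        rw [Finset.mem_filter] at hb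
        simpa using (heq x b hx.1 hb.1 hx.2 hb.2).symm)
    have hvx : v ≠ x := by
      rintro rfl
      exact hF _ hx.1 ⟨_, huv, by simp⟩
    have hdeg : 2 ≤ K.degree u := by
      rw [← Finset.card_pair hvx]
      refine Finset.card_le_card fun a ha => ?_
      have huv' : K.Adj u v := hM.1 _ huv
      rcases Finset.mem_insert.1 ha with rfl | ha
      · simpa using huv'
      · rw [Finset.mem_singleton.1 ha]
        simpa using hx.2
    linarith [hd u]
  let S : Sym2 V → Finset (Σ _ : V, V) := fun e =>
    (F.sigma fun x => K.neighborFinset x).filter fun q => q.2 ∈ e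
  have hcover : (F.sigma fun x => K.neighborFinset x) ⊆ M.biUnion S := by
    rintro ⟨x, u⟩ h
    have h' := h
    rw [Finset.mem_sigma, SimpleGraph.mem_neighborFinset] at h'
    obtain ⟨e, he, hue⟩ := matched_of_adj_of_not_matched hAug₀ (hF x h'.1) h'.2
    exact Finset.mem_biUnion.2 ⟨e, he, Finset.mem_filter.2 ⟨h, hue⟩⟩
  calc ∑ x ∈ F, K.degree x = (F.sigma fun x => K.neighborFinset x).card := by
        simp [Finset.card_sigma]
    _ ≤ (M.biUnion S).card := Finset.card_le_card hcover
    _ ≤ M.card * d := Finset.card_biUnion_le_card_mul _ _ _ fun e he => ?_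
  induction e using Sym2.ind with
  | _ u v =>
    have hS : S s(u, v) ⊆ (F.filter (K.Adj u)).image (fun x => ⟨x, u⟩) ∪
        (F.filter (K.Adj v)).image (fun x => ⟨x, v⟩) := by
      rintro ⟨x, w⟩ h
      simp only [S, Finset.mem_filter, Finset.mem_sigma, SimpleGraph.mem_neighborFinset,
        Sym2.mem_iff] at h
      obtain ⟨⟨hx, hxw⟩, rfl | rfl⟩ := h <;> simp [hx, hxw.symm]
    calc (S s(u, v)).card ≤ _ := Finset.card_le_card hS
      _ ≤ _ := Finset.card_union_le _ _
      _ ≤ _ := add_le_add Finset.card_image_le Finset.card_image_le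
      _ ≤ d := hends u v he

/-- Let `M` be a matching in an `(ε,c)`-kernel `K` of `G` (with `c ≥ 1`, `0 ≤ ε < 1/3`)
such that every augmenting path in `K` with respect to `M` has length at least five.
Then the set `F_T` of tight nodes unmatched in `M` satisfies `|F_T| ≤ (1+3ε)·|M|`. -/
theorem stmt_11 {V : Type*} [Fintype V] (G K : SimpleGraph V) (T : Set V)
    (ε c : ℝ) (hc : 1 ≤ c) (hε0 : 0 ≤ ε) (hε : ε < 1 / 3)
    (hker : IsKernel G K T ε c)
    (M : Finset (Sym2 V)) (hM : IsMatchingOn K M)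
    (hAug : ∀ (k : ℕ) (p : ℕ → V), IsAugPath K M k p → 5 ≤ 2 * k + 1) :
    (({v : V | v ∈ T ∧ ¬ Matched M v} : Set V).ncard : ℝ) ≤ (1 + 3 * ε) * (M.card : ℝ) := by
  classical
  obtain ⟨-, hupper, hlower, -⟩ := hker
  have hcard : ∀ v, (K.neighborSet v).ncard = K.degree v := fun v => by
    rw [Set.ncard_eq_toFinset_card', ← K.card_neighborFinset_eq_degree, SimpleGraph.neighborFinset]
  simp only [hcard] at hupper hlower
  set F : Finset V := Finset.univ.filter fun v => v ∈ T ∧ ¬ Matched M v with hFdef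
  have hF : ({v : V | v ∈ T ∧ ¬ Matched M v} : Set V).ncard = F.card := by
    rw [← Set.ncard_coe_finset]
    simp [hFdef]
  have hpos : 0 ≤ (1 + ε) * c := by positivity
  have hsum := sum_degree_le_card_mul (F := F) (d := ⌊(1 + ε) * c⌋₊) hM
    (fun p hp => by have := hAug 0 p hp; omega) (fun p hp => by have := hAug 1 p hp; omega)
    (fun v => Nat.le_floor (hupper v)) (fun x hx => (Finset.mem_filter.1 hx).2.2)
  have hlow : F.card * ((1 - ε) * c) ≤ ((∑ x ∈ F, K.degree x : ℕ) : ℝ) := by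
    rw [← nsmul_eq_mul, Nat.cast_sum]
    exact Finset.card_nsmul_le_sum _ _ _ fun x hx => hlower x (Finset.mem_filter.1 hx).2.1
  have hup : ((∑ x ∈ F, K.degree x : ℕ) : ℝ) ≤ M.card * ((1 + ε) * c) := by
    refine (Nat.cast_le.2 hsum).trans ?_
    rw [Nat.cast_mul]
    gcongr
    exact Nat.floor_le hpos
  have hratio : 1 + ε ≤ (1 - ε) * (1 + 3 * ε) := by nlinarith
  have hpos' : 0 < (1 - ε) * c := mul_pos (by linarith) (by linarith)
  rw [hF]
  refine le_of_mul_le_mul_right ?_ hpos'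
  calc (F.card : ℝ) * ((1 - ε) * c) ≤ M.card * ((1 + ε) * c) := hlow.trans hup
    _ ≤ M.card * ((1 - ε) * (1 + 3 * ε) * c) := by gcongr
    _ = (1 + 3 * ε) * M.card * ((1 - ε) * c) := by ring
end

section
/- For every positive even integer c, there exist a finite simple undirected graph G = (V,E), a (1/c,c)-kernel κ(G) = (V,κ(E)) of G, and a maximal matching M in κ(G) such that G contains a matching of size at least 4·|M|. -/
/-- The vertices of the tight example: `(i, s, p)` is the `i`-th vertex on side `s` of a complete
bipartite graph when `p = false`, and the pendant vertex attached to it when `p = true`. -/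
abbrev PendantVertex (h : ℕ) : Type := (Fin h × Bool) × Bool × Bool

/-- A complete bipartite graph with `2h` vertices on each side, plus a perfect matching inside the
side `true`; the pendant vertices are isolated. -/
def bipartiteCore (h : ℕ) : SimpleGraph (PendantVertex h) where
  Adj u v := u.2.2 = false ∧ v.2.2 = false ∧
    (u.2.1 ≠ v.2.1 ∨ (u.2.1 = true ∧ v.2.1 = true ∧ u.1.1 = v.1.1 ∧ u.1.2 ≠ v.1.2))
  symm := ⟨by
    rintro u v ⟨hu, hv, huv⟩
    exact ⟨hv, hu, huv.imp Ne.symm fun ⟨a, b, e, n⟩ => ⟨b, a, e.symm, n.symm⟩⟩⟩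
  loopless := ⟨by
    rintro u ⟨-, -, huu | ⟨-, -, -, huu⟩⟩ <;> exact huu rfl⟩

/-- The core together with a pendant edge at each of its vertices. -/
def pendantGraph (h : ℕ) : SimpleGraph (PendantVertex h) where
  Adj u v := (bipartiteCore h).Adj u v ∨ (u.1 = v.1 ∧ u.2.1 = v.2.1 ∧ u.2.2 ≠ v.2.2)
  symm := ⟨by
    rintro u v (huv | ⟨a, b, n⟩)
    · exact Or.inl huv.symm
    · exact Or.inr ⟨a.symm, b.symm, n.symm⟩⟩
  loopless := ⟨by
    rintro u (huu | ⟨-, -, huu⟩)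
    · exact huu.ne rfl
    · exact huu rfl⟩

/-- The perfect matching inside the side `true` of the core. -/
def sideMatching (h : ℕ) : Finset (Sym2 (PendantVertex h)) :=
  Finset.univ.image fun k : Fin h => s(((k, true), true, false), ((k, false), true, false))

/-- The matching formed by all pendant edges. -/
def pendantMatching (h : ℕ) : Finset (Sym2 (PendantVertex h)) :=
  Finset.univ.image fun x : (Fin h × Bool) × Bool => s((x.1, x.2, false), (x.1, x.2, true))

/-- The core vertices on side `s`. -/
def coreSide (h : ℕ) (s : Bool) : Set (PendantVertex h) :=
  Set.range fun i : Fin h × Bool => (i, s, false)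

theorem ncard_coreSide (h : ℕ) (s : Bool) : (coreSide h s).ncard = h + h := by
  have hinj : Function.Injective fun i : Fin h × Bool => ((i, s, false) : PendantVertex h) :=
    fun i j hij => congrArg Prod.fst hij
  rw [coreSide, ← Set.image_univ, Set.ncard_image_of_injective _ hinj, Set.ncard_univ]
  simp [Nat.card_eq_fintype_card]
  omega

theorem ncard_neighborSet_bipartiteCore_le (h : ℕ) (v : PendantVertex h) :
    ((bipartiteCore h).neighborSet v).ncard ≤ h + h + 1 := by
  have hsub : (bipartiteCore h).neighborSet v ⊆
      insert ((v.1.1, !v.1.2), true, false) (coreSide h (!v.2.1)) := by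
    rintro ⟨⟨k, b⟩, s, p⟩ ⟨-, hp, hs | ⟨-, hs, hk, hb⟩⟩
    · refine Or.inr ⟨(k, b), ?_⟩
      simp_all
      grind
    · refine Or.inl ?_
      simp_all
      exact Bool.eq_not.mpr (Ne.symm hb)
  calc _ ≤ _ := Set.ncard_le_ncard hsub (Set.toFinite _)
    _ ≤ _ := Set.ncard_insert_le _ _
    _ = _ := by rw [ncard_coreSide]

theorem le_ncard_neighborSet_bipartiteCore (h : ℕ) (v : PendantVertex h) (hv : v.2.2 = false) :
    h + h ≤ ((bipartiteCore h).neighborSet v).ncard := by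
  rw [← ncard_coreSide h (!v.2.1)]
  refine Set.ncard_le_ncard ?_ (Set.toFinite _)
  rintro _ ⟨i, rfl⟩
  exact ⟨hv, rfl, Or.inl (by simp)⟩

theorem isKernel_bipartiteCore (h c : ℕ) (hc : 0 < c) (hch : c = h + h) :
    IsKernel (pendantGraph h) (bipartiteCore h) {v | v.2.2 = false} (1 / (c : ℝ)) (c : ℝ) := by
  have hc0 : (c : ℝ) ≠ 0 := by positivity
  refine ⟨fun u v huv => Or.inl huv, fun v => ?_, fun v hv => ?_, ?_⟩
  · have hle : (((bipartiteCore h).neighborSet v).ncard : ℝ) ≤ c + 1 := by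
      exact_mod_cast hch ▸ ncard_neighborSet_bipartiteCore_le h v
    rw [add_mul, one_div_mul_cancel hc0]
    linarith
  · have hle : (c : ℝ) ≤ ((bipartiteCore h).neighborSet v).ncard := by
      exact_mod_cast hch ▸ le_ncard_neighborSet_bipartiteCore h v hv
    rw [sub_mul, one_div_mul_cancel hc0]
    linarith
  · rintro u v (huv | ⟨-, -, huv⟩) hu hv
    · exact huv
    · simp only [Set.mem_ofPred_eq, Bool.not_eq_false] at hu hv
      exact absurd (hu.trans hv.symm) huv

theorem isMatchingOn_sideMatching (h : ℕ) :
    IsMatchingOn (bipartiteCore h) (sideMatching h) := by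
  simp only [IsMatchingOn, sideMatching, Finset.mem_image, Finset.mem_univ, true_and]
  refine ⟨?_, ?_⟩
  · rintro _ ⟨k, rfl⟩
    exact ⟨rfl, rfl, Or.inr ⟨rfl, rfl, rfl, by simp⟩⟩
  · rintro _ ⟨k, rfl⟩ _ ⟨l, rfl⟩ hne v hk hl
    apply hne
    have hvk : v.1.1 = k := by
      rcases Sym2.mem_iff.mp hk with rfl | rfl <;> rfl
    have hvl : v.1.1 = l := by
      rcases Sym2.mem_iff.mp hl with rfl | rfl <;> rfl
    rw [← hvk, ← hvl]

theorem matched_sideMatching (h : ℕ) (v : PendantVertex h) (hs : v.2.1 = true)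
    (hp : v.2.2 = false) : Matched (sideMatching h) v := by
  obtain ⟨⟨k, b⟩, s, p⟩ := v
  obtain rfl : s = true := hs
  obtain rfl : p = false := hp
  refine ⟨_, Finset.mem_image_of_mem _ (Finset.mem_univ k), ?_⟩
  cases b <;> simp

theorem sideMatching_maximal (h : ℕ) (u v : PendantVertex h) (huv : (bipartiteCore h).Adj u v) :
    Matched (sideMatching h) u ∨ Matched (sideMatching h) v := by
  obtain ⟨hu, hv, hne | ⟨hs, -⟩⟩ := huv
  · by_cases hs : u.2.1 = true
    · exact Or.inl (matched_sideMatching h u hs hu)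
    · exact Or.inr (matched_sideMatching h v (by grind) hv)
  · exact Or.inl (matched_sideMatching h u hs hu)

theorem isMatchingOn_pendantMatching (h : ℕ) :
    IsMatchingOn (pendantGraph h) (pendantMatching h) := by
  simp only [IsMatchingOn, pendantMatching, Finset.mem_image, Finset.mem_univ, true_and]
  refine ⟨?_, ?_⟩
  · rintro _ ⟨x, rfl⟩
    exact Or.inr ⟨rfl, rfl, by simp⟩
  · rintro _ ⟨x, rfl⟩ _ ⟨y, rfl⟩ hne v hx hy
    apply hne
    have hvx : (v.1, v.2.1) = x := by
      rcases Sym2.mem_iff.mp hx with rfl | rfl <;> rfl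
    have hvy : (v.1, v.2.1) = y := by
      rcases Sym2.mem_iff.mp hy with rfl | rfl <;> rfl
    rw [← hvx, ← hvy]

theorem card_pendantMatching (h : ℕ) : (pendantMatching h).card = 4 * h := by
  rw [pendantMatching, Finset.card_image_of_injective]
  · simp
    omega
  · rintro ⟨i, s⟩ ⟨j, t⟩ hij
    simpa using hij

theorem card_sideMatching (h : ℕ) : (sideMatching h).card = h := by
  rw [sideMatching, Finset.card_image_of_injective]
  · simp
  · intro k l hkl
    simpa using hkl

/-- The example with a nonempty maximal matching, so that the ratio `4` is really attained. -/
theorem exists_kernel_maximal_matching_ratio_four (c : ℕ) (hc : 0 < c) (hceven : Even c) :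
    ∃ (V : Type) (_ : Fintype V) (G K : SimpleGraph V) (T : Set V)
      (M : Finset (Sym2 V)),
      M.Nonempty ∧
      IsKernel G K T (1 / (c : ℝ)) (c : ℝ) ∧
      IsMatchingOn K M ∧
      (∀ u v : V, K.Adj u v → Matched M u ∨ Matched M v) ∧
      ∃ M' : Finset (Sym2 V), IsMatchingOn G M' ∧ 4 * M.card ≤ M'.card := by
  obtain ⟨h, hch⟩ := hceven
  refine ⟨PendantVertex h, inferInstance, pendantGraph h, bipartiteCore h, {v | v.2.2 = false},
    sideMatching h, ?_, isKernel_bipartiteCore h c hc hch, isMatchingOn_sideMatching h,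
    sideMatching_maximal h, pendantMatching h, isMatchingOn_pendantMatching h, ?_⟩
  · rw [← Finset.card_pos, card_sideMatching]
    omega
  · rw [card_pendantMatching, card_sideMatching]


/-- For every positive even integer `c`, there exist a finite graph `G`, a
`(1/c,c)`-kernel `K` (with tight set `T`) of `G`, and a maximal matching `M` in `K`
such that `G` contains a matching of size at least `4·|M|`. -/
theorem stmt_13 (c : ℕ) (hc : 0 < c) (hceven : Even c) :
    ∃ (V : Type) (_ : Fintype V) (G K : SimpleGraph V) (T : Set V)
      (M : Finset (Sym2 V)),
      IsKernel G K T (1 / (c : ℝ)) (c : ℝ) ∧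
      IsMatchingOn K M ∧
      (∀ u v : V, K.Adj u v → Matched M u ∨ Matched M v) ∧
      ∃ M' : Finset (Sym2 V), IsMatchingOn G M' ∧ 4 * M.card ≤ M'.card := by
  obtain ⟨V, hV, G, K, T, M, -, hM⟩ := exists_kernel_maximal_matching_ratio_four c hc hceven
  exact ⟨V, hV, G, K, T, M, hM⟩
end

section
/- Let 𝒢 be a finite simple undirected graph, let k be a positive integer, and let M be a matching in 𝒢 such that every augmenting path in 𝒢 with respect to M has length at least 2k+1. Then M is a (1+1/k)-approximate maximum matching in 𝒢: for every matching M' in 𝒢, |M'| ≤ (1+1/k) · |M|. -/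
/-- The partner function of a matching: an involution exchanging the endpoints of each edge of `M`
and fixing every unmatched vertex. -/
theorem IsMatchingOn.exists_involutive {V : Type*} [Fintype V] [DecidableEq V] {H : SimpleGraph V}
    {M : Finset (Sym2 V)} (hM : IsMatchingOn H M) :
    ∃ f : V → V, Function.Involutive f ∧ (∀ v, f v ≠ v → s(v, f v) ∈ M) ∧
      (∀ v w, s(v, w) ∈ M → f v = w) ∧
      (Finset.univ.filter fun v => f v ≠ v).card = 2 * M.card := by
  classical
  have huniq : ∀ v w w', s(v, w) ∈ M → s(v, w') ∈ M → w = w' := by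
    intro v w w' h h'
    by_contra hne
    refine hM.2 _ h _ h' ?_ v (by simp) (by simp)
    exact fun heq => hne (Sym2.congr_right.1 heq)
  have hloop : ∀ v w, s(v, w) ∈ M → v ≠ w := fun v w h => (hM.1 _ h : H.Adj v w).ne
  let f : V → V := fun v => if h : ∃ w, s(v, w) ∈ M then h.choose else v
  have hf : ∀ v w, s(v, w) ∈ M → f v = w := by
    intro v w h
    have hex : ∃ w, s(v, w) ∈ M := ⟨w, h⟩
    simp only [f, dif_pos hex]
    exact huniq v _ _ hex.choose_spec h
  have hf' : ∀ v, f v ≠ v → s(v, f v) ∈ M := by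
    intro v h
    by_cases hex : ∃ w, s(v, w) ∈ M
    · simp only [f, dif_pos hex]
      exact hex.choose_spec
    · simp [f, dif_neg hex] at h
  refine ⟨f, ?_, hf', hf, ?_⟩
  · intro v
    by_cases h : f v = v
    · rw [h, h]
    · exact hf _ _ (by rw [Sym2.eq_swap]; exact hf' v h)
  · have hset : (Finset.univ.filter fun v => f v ≠ v) = M.biUnion Sym2.toFinset := by
      ext v
      simp only [Finset.mem_filter, Finset.mem_univ, true_and, Finset.mem_biUnion,
        Sym2.mem_toFinset]
      constructor
      · exact fun h => ⟨_, hf' v h, by simp⟩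
      · rintro ⟨e, he, hv⟩
        obtain ⟨w, rfl⟩ := hv
        rw [hf v w he]
        exact (hloop v w he).symm
    rw [hset, Finset.card_biUnion, Finset.sum_const_nat (m := 2), mul_comm]
    · intro e he
      exact Sym2.card_toFinset_of_not_isDiag e (H.not_isDiag_of_mem_edgeSet (hM.1 e he))
    · intro e he e' he' hne
      rw [Function.onFun, Finset.disjoint_left]
      simpa only [Sym2.mem_toFinset] using hM.2 e he e' he' hne

/-- The walk from `v` obtained by applying `f` and `g` alternately, `f` first. -/
def alternatingWalk {V : Type*} (f g : V → V) (v : V) : ℕ → V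
  | 0 => v
  | n + 1 => if Even n then f (alternatingWalk f g v n) else g (alternatingWalk f g v n)

section AlternatingWalk

variable {V : Type*} {f g : V → V}

theorem alternatingWalk_succ_of_even {v : V} {n : ℕ} (h : Even n) :
    alternatingWalk f g v (n + 1) = f (alternatingWalk f g v n) := by
  simp [alternatingWalk, h]

theorem alternatingWalk_succ_of_odd {v : V} {n : ℕ} (h : Odd n) :
    alternatingWalk f g v (n + 1) = g (alternatingWalk f g v n) := by
  simp [alternatingWalk, h]

/-- Two walks that meet at indices of the same parity can be rewound together. -/
theorem eq_alternatingWalk_of_eq_add_even (hf : Function.Involutive f)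
    (hg : Function.Involutive g) {u v : V} {i d : ℕ} (hd : Even d)
    (h : alternatingWalk f g v i = alternatingWalk f g u (i + d)) :
    v = alternatingWalk f g u d := by
  induction i with
  | zero => simpa [alternatingWalk] using h
  | succ i ih =>
    apply ih
    rw [add_right_comm] at h
    rcases Nat.even_or_odd i with hi | hi
    · rw [alternatingWalk_succ_of_even hi, alternatingWalk_succ_of_even (hi.add hd)] at h
      exact hf.injective h
    · rw [alternatingWalk_succ_of_odd hi, alternatingWalk_succ_of_odd (hi.add_even hd)] at h
      exact hg.injective h

/-- Two walks that meet at indices of opposite parity traverse each other backwards. -/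
theorem alternatingWalk_succ_eq_of_eq_succ (hf : Function.Involutive f)
    (hg : Function.Involutive g) {u v : V} {i j : ℕ} (hij : Even (i + j))
    (h : alternatingWalk f g v i = alternatingWalk f g u (j + 1)) :
    alternatingWalk f g v (i + 1) = alternatingWalk f g u j := by
  rcases Nat.even_or_odd j with hj | hj
  · have hi : Even i := by grind
    rw [alternatingWalk_succ_of_even hi, h, alternatingWalk_succ_of_even hj, hf]
  · have hi : Odd i := by grind
    rw [alternatingWalk_succ_of_odd hi, h, alternatingWalk_succ_of_odd hj, hg]

theorem alternatingWalk_add_eq_of_eq_add (hf : Function.Involutive f)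
    (hg : Function.Involutive g) {u v : V} {i j d : ℕ} (hij : Odd (i + j + d))
    (h : alternatingWalk f g v i = alternatingWalk f g u (j + d)) :
    alternatingWalk f g v (i + d) = alternatingWalk f g u j := by
  induction d generalizing i with
  | zero => exact h
  | succ d ih =>
    rw [← Nat.succ_add_eq_add_succ]
    refine ih (by grind) ?_
    exact alternatingWalk_succ_eq_of_eq_succ hf hg (by grind) h

/-- A walk that starts at a fixed point of `g` and makes no trivial step visits distinct
vertices. -/
theorem alternatingWalk_ne (hf : Function.Involutive f) (hg : Function.Involutive g) {v : V}
    (hv : g v = v) {N : ℕ}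
    (hN : ∀ n < N, alternatingWalk f g v (n + 1) ≠ alternatingWalk f g v n)
    {i j : ℕ} (hij : i < j) (hj : j ≤ N) :
    alternatingWalk f g v i ≠ alternatingWalk f g v j := by
  intro h
  obtain ⟨d, rfl⟩ := Nat.exists_eq_add_of_lt hij
  rcases Nat.even_or_odd d with hd | hd
  · obtain ⟨c, rfl⟩ := hd
    have h' := alternatingWalk_add_eq_of_eq_add (i := i) (j := i + c + 1) (d := c) hf hg
      (by grind) (by rw [h]; congr 1; omega)
    exact hN (i + c) (by omega) h'.symm
  · have h' := eq_alternatingWalk_of_eq_add_even (d := d + 1) hf hg (by grind) h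
    have h1 : alternatingWalk f g v (d + 1) = g (alternatingWalk f g v d) :=
      alternatingWalk_succ_of_odd hd
    refine hN d (by omega) ?_
    rw [← h', ← hg (alternatingWalk f g v d), ← h1, ← h', hv]

/-- If no walk from a fixed point of `g` reaches another fixed point of `g` through fewer than
`2 * k` nontrivial steps, it avoids the fixed points of `g` as long as `f` makes it move. -/
theorem apply_alternatingWalk_ne (hg : Function.Involutive g) {k m : ℕ} (hmk : m ≤ k) {v : V}
    (haug : ∀ a < k, (∀ n ≤ 2 * a, alternatingWalk f g v (n + 1) ≠ alternatingWalk f g v n) →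
      alternatingWalk f g v (2 * a + 2) ≠ alternatingWalk f g v (2 * a + 1))
    (hm : ∀ i < m, alternatingWalk f g v (2 * i + 1) ≠ alternatingWalk f g v (2 * i))
    {n : ℕ} (hn : 1 ≤ n) (hnm : n ≤ 2 * m) :
    g (alternatingWalk f g v n) ≠ alternatingWalk f g v n := by
  have hstep : ∀ n < 2 * m, alternatingWalk f g v (n + 1) ≠ alternatingWalk f g v n := by
    intro n
    induction n using Nat.strong_induction_on with
    | _ n ih =>
      intro hn
      rcases Nat.even_or_odd' n with ⟨a, rfl | rfl⟩
      · exact hm a (by omega)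
      · exact haug a (by omega) fun n hn' => ih n (by omega) (by omega)
  rcases Nat.even_or_odd n with he | ho
  · obtain ⟨l, rfl⟩ := Nat.exists_eq_add_of_le' hn
    have hl : Odd l := by grind
    have := hstep l (by omega)
    rw [alternatingWalk_succ_of_odd hl] at this ⊢
    rw [hg]
    exact this.symm
  · have := hstep n (by grind)
    rwa [alternatingWalk_succ_of_odd ho] at this

/-- If no walk from a fixed point of `g` reaches another fixed point of `g` through fewer than
`2 * k` nontrivial steps, then the surplus of fixed points of `g` over those of `f`, times `k`, is
at most the number of points moved by `g`. -/
theorem mul_card_fixed_le [Fintype V] [DecidableEq V] (hf : Function.Involutive f)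
    (hg : Function.Involutive g) {k : ℕ}
    (haug : ∀ v, g v = v → ∀ a < k,
      (∀ n ≤ 2 * a, alternatingWalk f g v (n + 1) ≠ alternatingWalk f g v n) →
      alternatingWalk f g v (2 * a + 2) ≠ alternatingWalk f g v (2 * a + 1)) :
    k * (Finset.univ.filter fun v => g v = v).card ≤
      k * (Finset.univ.filter fun v => f v = v).card +
        (Finset.univ.filter fun v => g v ≠ v).card := by
  classical
  let long : V → Prop := fun v =>
    ∀ i < k, alternatingWalk f g v (2 * i + 1) ≠ alternatingWalk f g v (2 * i)
  set A := Finset.univ.filter fun v => g v = v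
  have hlong : k * (A.filter long).card ≤ (Finset.univ.filter fun v => g v ≠ v).card := by
    have hcard : ((A.filter long) ×ˢ Finset.Icc 1 k).card = k * (A.filter long).card := by
      simp [mul_comm]
    rw [← hcard]
    have havoid : ∀ v ∈ A.filter long, ∀ n, 1 ≤ n → n ≤ 2 * k →
        g (alternatingWalk f g v n) ≠ alternatingWalk f g v n := by
      intro v hv n h1 h2
      simp only [A, Finset.mem_filter, Finset.mem_univ, true_and] at hv
      exact apply_alternatingWalk_ne hg le_rfl (haug v hv.1) hv.2 h1 h2
    have hinj : ∀ v ∈ A.filter long, ∀ u ∈ A.filter long, ∀ i j, 1 ≤ i → i ≤ j → j ≤ k →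
        alternatingWalk f g v i = alternatingWalk f g u j → v = u ∧ i = j := by
      intro v hv u hu i j hi hij hj h
      have hgv : g v = v := by simp [A] at hv; exact hv.1
      obtain ⟨d, rfl⟩ := Nat.exists_eq_add_of_le hij
      rcases Nat.even_or_odd d with hd | hd
      · have h' := eq_alternatingWalk_of_eq_add_even hf hg hd h
        rcases Nat.eq_zero_or_pos d with rfl | hpos
        · exact ⟨h', rfl⟩
        · exact absurd (h' ▸ hgv) (havoid u hu d hpos (by omega))
      · have h' := alternatingWalk_add_eq_of_eq_add (i := i + d) (j := 0) (d := i) (v := u) (u := v)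
          hf hg (by grind) (by simpa using h.symm)
        simp only [alternatingWalk] at h'
        exact absurd (h'.symm ▸ hgv) (havoid u hu (i + d + i) (by omega) (by omega))
    apply Finset.card_le_card_of_injOn fun x => alternatingWalk f g x.1 x.2
    · rintro ⟨v, i⟩ hx
      simp only [Finset.coe_product, Set.mem_prod, Finset.mem_coe, Finset.mem_Icc] at hx
      simpa using havoid v hx.1 i hx.2.1 (by omega)
    · rintro ⟨v, i⟩ hx ⟨u, j⟩ hy h
      simp only [Finset.coe_product, Set.mem_prod, Finset.mem_coe, Finset.mem_Icc] at hx hy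
      rcases le_total i j with hij | hij
      · obtain ⟨rfl, rfl⟩ := hinj v hx.1 u hy.1 i j hx.2.1 hij hy.2.2 h
        rfl
      · obtain ⟨rfl, rfl⟩ := hinj u hy.1 v hx.1 j i hy.2.1 hij hx.2.2 h.symm
        rfl
  have hshort : (A.filter fun v => ¬ long v).card ≤
      (Finset.univ.filter fun v => f v = v).card := by
    have hex : ∀ v, ∃ m, ¬ long v → m < k ∧
        alternatingWalk f g v (2 * m + 1) = alternatingWalk f g v (2 * m) ∧
        ∀ i < m, alternatingWalk f g v (2 * i + 1) ≠ alternatingWalk f g v (2 * i) := by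
      intro v
      by_cases hv : long v
      · exact ⟨0, fun h => absurd hv h⟩
      · have hv' : ∃ i, i < k ∧
            alternatingWalk f g v (2 * i + 1) = alternatingWalk f g v (2 * i) := by
          simpa [long] using hv
        refine ⟨Nat.find hv', fun _ => ⟨(Nat.find_spec hv').1, (Nat.find_spec hv').2, ?_⟩⟩
        intro i hi h
        exact Nat.find_min hv' hi ⟨hi.trans (Nat.find_spec hv').1, h⟩
    choose m hm using hex
    have hinj : ∀ v ∈ A.filter (fun v => ¬ long v), ∀ u ∈ A.filter (fun v => ¬ long v),
        m v ≤ m u → alternatingWalk f g v (2 * m v) = alternatingWalk f g u (2 * m u) →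
        v = u := by
      intro v hv u hu hle h
      rw [Finset.mem_filter] at hv hu
      have hgv : g v = v := by simpa [A] using hv.1
      have hgu : g u = u := by simpa [A] using hu.1
      obtain ⟨d, hd⟩ := Nat.exists_eq_add_of_le hle
      have h' := eq_alternatingWalk_of_eq_add_even (d := 2 * d) hf hg (by simp)
        (by rw [h, hd, mul_add])
      rcases Nat.eq_zero_or_pos d with rfl | hpos
      · simpa [alternatingWalk] using h'
      · obtain ⟨hk, -, hmin⟩ := hm u hu.2
        exact absurd (h' ▸ hgv)
          (apply_alternatingWalk_ne hg hk.le (haug u hgu) hmin (n := 2 * d) (by omega) (by omega))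
    apply Finset.card_le_card_of_injOn fun v => alternatingWalk f g v (2 * m v)
    · intro v hv
      have hv' := (hm v (Finset.mem_filter.1 hv).2).2.1
      rw [alternatingWalk_succ_of_even (by simp)] at hv'
      simpa using hv'
    · intro v hv u hu h
      rcases le_total (m v) (m u) with hle | hle
      · exact hinj v hv u hu hle h
      · exact (hinj u hu v hv hle h.symm).symm
  rw [← Finset.card_filter_add_card_filter_not (s := A) long, mul_add, add_comm]
  exact add_le_add (Nat.mul_le_mul_left k hshort) hlong

end AlternatingWalk

/-- If `M` is a matching in a finite graph `H` such that every augmenting path in `H`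
with respect to `M` has length at least `2k+1` (for a positive integer `k`), then `M`
is a `(1+1/k)`-approximate maximum matching of `H`. -/
theorem stmt_14 {V : Type*} [Fintype V] (H : SimpleGraph V) (k : ℕ) (hk : 1 ≤ k)
    (M : Finset (Sym2 V)) (hM : IsMatchingOn H M)
    (hAug : ∀ (k' : ℕ) (p : ℕ → V), IsAugPath H M k' p → 2 * k + 1 ≤ 2 * k' + 1)
    (M' : Finset (Sym2 V)) (hM' : IsMatchingOn H M') :
    (M'.card : ℝ) ≤ (1 + 1 / (k : ℝ)) * (M.card : ℝ) := by
  classical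
  obtain ⟨g, hg, hgM, hMg, hgcard⟩ := hM.exists_involutive
  obtain ⟨f, hf, hfM, hMf, hfcard⟩ := hM'.exists_involutive
  have hunmatched : ∀ v, g v = v → ¬ Matched M v := by
    rintro v hv ⟨e, he, w, rfl⟩
    exact (hM.1 _ he : H.Adj v w).ne (hv.symm.trans (hMg v w he))
  have key := mul_card_fixed_le (k := k) hf hg (by
    intro v hv a ha hstep hend
    have hne : ∀ i j, i < j → j ≤ 2 * a + 1 →
        alternatingWalk f g v i ≠ alternatingWalk f g v j := fun i j hij hj =>
      alternatingWalk_ne (N := 2 * a + 1) hf hg hv (fun n hn => hstep n (by omega)) hij hj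
    have hodd : ∀ n ≤ 2 * a, Odd n →
        s(alternatingWalk f g v n, alternatingWalk f g v (n + 1)) ∈ M := by
      intro n hn ho
      have := hstep n hn
      rw [alternatingWalk_succ_of_odd ho] at this ⊢
      exact hgM _ this
    have := hAug a (alternatingWalk f g v) ⟨?_, ?_, ?_, hunmatched v hv, ?_⟩
    · omega
    · intro i j hi hj h
      rcases lt_trichotomy i j with hij | hij | hij
      · exact absurd h (hne i j hij hj)
      · exact hij
      · exact absurd h.symm (hne j i hij hi)
    · intro n hn
      rcases Nat.even_or_odd n with he | ho
      · have := hstep n hn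
        rw [alternatingWalk_succ_of_even he] at this ⊢
        exact hM'.1 _ (hfM _ this)
      · exact hM.1 _ (hodd n hn ho)
    · intro n hn
      refine ⟨fun h => ?_, hodd n hn⟩
      by_contra he
      rw [Nat.not_odd_iff_even] at he
      have h' := hMg _ _ h
      rcases n with _ | n
      · exact hstep 0 hn (h'.symm.trans hv)
      · have ho : Odd n := by grind
        rw [alternatingWalk_succ_of_odd ho, hg] at h'
        exact hne n (n + 2) (by omega) (by omega) h'
    · apply hunmatched
      rwa [alternatingWalk_succ_of_odd (by simp)] at hend)
  have hgtotal := Finset.card_filter_add_card_filter_not (s := Finset.univ) fun v => g v = v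
  have hftotal := Finset.card_filter_add_card_filter_not (s := Finset.univ) fun v => f v = v
  have hmain : k * M'.card ≤ k * M.card + M.card := by
    have hfg : (Finset.univ.filter fun v => g v = v).card + 2 * M.card =
        (Finset.univ.filter fun v => f v = v).card + 2 * M'.card := by
      rw [← hgcard, ← hfcard]
      exact hgtotal.trans hftotal.symm
    rw [hgcard] at key
    nlinarith [congrArg (k * ·) hfg]
  have hk0 : (0 : ℝ) < k := by exact_mod_cast hk
  have hmain' : (k : ℝ) * M'.card ≤ k * M.card + M.card := by exact_mod_cast hmain
  rw [← mul_le_mul_iff_right₀ hk0]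
  calc (k : ℝ) * M'.card ≤ k * M.card + M.card := hmain'
    _ = k * ((1 + 1 / (k : ℝ)) * M.card) := by field_simp
end

section
/- Let G = (V,E) be a finite simple undirected graph and let x be a fractional matching in G. Then the size of x is at most 3/2 times the maximum size of an (integral) matching in G: ∑_{e∈E} x(e) ≤ (3/2) · ν(G), where ν(G) denotes the maximum cardinality of a matching in G. -/
/-- `ν(G)`: the maximum cardinality of a matching in `G`. -/
noncomputable def maxMatchingSize {V : Type*} (G : SimpleGraph V) : ℕ :=
  sSup {n : ℕ | ∃ M : Finset (Sym2 V), IsMatchingOn G M ∧ M.card = n}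

/-- A finite set of arcs of `H` in which every vertex is the tail of at most one arc and the head
of at most one arc contains a matching with at least a third as many edges. -/
theorem exists_isMatchingOn_card_le_three_mul {V : Type*} [DecidableEq V] (H : SimpleGraph V)
    (S : Finset (V × V)) (hadj : ∀ p ∈ S, H.Adj p.1 p.2)
    (hfst : Set.InjOn Prod.fst (S : Set (V × V))) (hsnd : Set.InjOn Prod.snd (S : Set (V × V))) :
    ∃ M : Finset (Sym2 V), IsMatchingOn H M ∧ (∀ e ∈ M, ∃ p ∈ S, e = s(p.1, p.2)) ∧
      S.card ≤ 3 * M.card := by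
  induction S using Finset.strongInduction with
  | H S ih =>
    rcases S.eq_empty_or_nonempty with rfl | ⟨⟨a, b⟩, hab⟩
    · exact ⟨∅, by simp [IsMatchingOn], by simp, by simp⟩
    set S' := S.filter (fun p => (p.1 ≠ a ∧ p.1 ≠ b) ∧ p.2 ≠ a ∧ p.2 ≠ b) with hS'
    have hsub : S' ⊆ S := Finset.filter_subset _ _
    have hmem : ∀ p ∈ S', (p.1 ≠ a ∧ p.1 ≠ b) ∧ p.2 ≠ a ∧ p.2 ≠ b := fun p hp =>
      (Finset.mem_filter.1 hp).2
    have hss : S' ⊂ S := (Finset.ssubset_iff_of_subset hsub).2 ⟨(a, b), hab, fun h => by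
      simpa using hmem _ h⟩
    have hsubC : (S' : Set (V × V)) ⊆ S := Finset.coe_subset.2 hsub
    obtain ⟨M, ⟨hME, hMd⟩, hMS, hcard⟩ := ih S' hss (fun p hp => hadj p (hsub hp))
      (hfst.mono hsubC) (hsnd.mono hsubC)
    have hdisj : ∀ e ∈ M, ∀ v ∈ s(a, b), v ∉ e := by
      intro e he v hv hve
      obtain ⟨p, hp, rfl⟩ := hMS e he
      have := hmem p hp
      simp only [Sym2.mem_iff] at hv hve
      grind
    have hnot : s(a, b) ∉ M := fun h => hdisj _ h a (by simp) (by simp)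
    have hout : (S.filter (fun p => p.1 = b)).card ≤ 1 := by
      refine Finset.card_le_one.2 fun p hp q hq => ?_
      rw [Finset.mem_filter] at hp hq
      exact hfst hp.1 hq.1 (hp.2.trans hq.2.symm)
    have hin : (S.filter (fun p => p.2 = a)).card ≤ 1 := by
      refine Finset.card_le_one.2 fun p hp q hq => ?_
      rw [Finset.mem_filter] at hp hq
      exact hsnd hp.1 hq.1 (hp.2.trans hq.2.symm)
    have hcover : S ⊆ S' ∪ ({(a, b)} ∪ (S.filter (fun p => p.1 = b) ∪
        S.filter (fun p => p.2 = a))) := by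
      intro p hp
      have h1 : p.1 = a → p = (a, b) := fun h => hfst hp hab h
      have h2 : p.2 = b → p = (a, b) := fun h => hsnd hp hab h
      simp only [hS', Finset.mem_union, Finset.mem_filter, Finset.mem_singleton]
      tauto
    refine ⟨insert s(a, b) M, ⟨?_, ?_⟩, ?_, ?_⟩
    · intro e he
      rcases Finset.mem_insert.1 he with rfl | he
      · exact hadj _ hab
      · exact hME e he
    · intro e he f hf hne v hve hvf
      rcases Finset.mem_insert.1 he with rfl | he <;> rcases Finset.mem_insert.1 hf with rfl | hf
      · exact hne rfl
      · exact hdisj f hf v hve hvf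
      · exact hdisj e he v hvf hve
      · exact hMd e he f hf hne v hve hvf
    · intro e he
      rcases Finset.mem_insert.1 he with rfl | he
      · exact ⟨(a, b), hab, rfl⟩
      · obtain ⟨p, hp, h⟩ := hMS e he
        exact ⟨p, hsub hp, h⟩
    · rw [Finset.card_insert_of_notMem hnot]
      have h0 := Finset.card_le_card hcover
      have h1 := Finset.card_union_le S' ({(a, b)} ∪ (S.filter (fun p => p.1 = b) ∪
        S.filter (fun p => p.2 = a)))
      have h2 := Finset.card_union_le {(a, b)} (S.filter (fun p => p.1 = b) ∪
        S.filter (fun p => p.2 = a))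
      have h3 := Finset.card_union_le (S.filter (fun p => p.1 = b)) (S.filter (fun p => p.2 = a))
      rw [Finset.card_singleton] at h2
      omega

/-- Hall's theorem with deficiency: if every set `A` of indices satisfies
`|A| ≤ |⋃ i ∈ A, t i| + d`, then there is a partial transversal missing at most `d` indices,
given here as its graph `S`. -/
theorem exists_partial_transversal_of_deficiency {ι α : Type*} [Fintype ι] [DecidableEq ι]
    [DecidableEq α] (t : ι → Finset α) (d : ℕ)
    (h : ∀ A : Finset ι, A.card ≤ (A.biUnion t).card + d) :
    ∃ S : Finset (ι × α), (∀ p ∈ S, p.2 ∈ t p.1) ∧ Set.InjOn Prod.fst (S : Set (ι × α)) ∧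
      Set.InjOn Prod.snd (S : Set (ι × α)) ∧ Fintype.card ι ≤ S.card + d := by
  have hall : ∀ A : Finset ι,
      A.card ≤ (A.biUnion fun i => (t i).disjSum (Finset.univ : Finset (Fin d))).card := by
    intro A
    rcases A.eq_empty_or_nonempty with rfl | ⟨i, hi⟩
    · simp
    have hsub : (A.biUnion t).disjSum (Finset.univ : Finset (Fin d)) ⊆
        A.biUnion fun i => (t i).disjSum (Finset.univ : Finset (Fin d)) := by
      rintro (a | k) ha
      · simpa using ha
      · simpa using ⟨i, hi⟩
    refine ((h A).trans (le_of_eq ?_)).trans (Finset.card_le_card hsub)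
    simp
  obtain ⟨f, hinj, hf⟩ := (Finset.all_card_le_biUnion_card_iff_exists_injective _).1 hall
  let g : ι → Finset (ι × α) := fun i => Sum.elim (fun a => {(i, a)}) (fun _ => ∅) (f i)
  have hg : ∀ i p, p ∈ g i ↔ p.1 = i ∧ f i = Sum.inl p.2 := by
    rintro i ⟨j, b⟩
    simp only [g]
    rcases f i with a | k
    · simp [eq_comm]
    · simp
  have hS : ∀ p, p ∈ Finset.univ.biUnion g ↔ f p.1 = Sum.inl p.2 := by
    intro p
    simp [hg]
  refine ⟨Finset.univ.biUnion g, ?_, ?_, ?_, ?_⟩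
  · intro p hp
    have := hf p.1
    rw [(hS p).1 hp] at this
    simpa using this
  · intro p hp q hq hpq
    have hp := (hS p).1 hp
    have hq := (hS q).1 hq
    exact Prod.ext hpq (Sum.inl_injective (hp.symm.trans ((congrArg f hpq).trans hq)))
  · intro p hp q hq hpq
    have hp := (hS p).1 hp
    have hq := (hS q).1 hq
    exact Prod.ext (hinj (hp.trans ((congrArg Sum.inl hpq).trans hq.symm))) hpq
  · have hsub : Finset.univ.image f ⊆
        ((Finset.univ.biUnion g).image Prod.snd).disjSum (Finset.univ : Finset (Fin d)) := by
      intro s hs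
      obtain ⟨i, -, rfl⟩ := Finset.mem_image.1 hs
      rcases hi : f i with a | k
      · exact Finset.inl_mem_disjSum.2 (Finset.mem_image.2 ⟨(i, a), (hS _).2 hi, rfl⟩)
      · simp
    have h1 := Finset.card_le_card hsub
    rw [Finset.card_image_of_injective _ hinj, Finset.card_univ, Finset.card_disjSum,
      Finset.card_univ, Fintype.card_fin] at h1
    exact h1.trans (Nat.add_le_add_right Finset.card_image_le d)

theorem IsMatchingOn.card_le_maxMatchingSize {V : Type*} [Fintype V] {G : SimpleGraph V}
    {M : Finset (Sym2 V)} (hM : IsMatchingOn G M) : M.card ≤ maxMatchingSize G := by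
  classical
  refine le_csSup ⟨Fintype.card (Sym2 V), ?_⟩ ⟨M, hM, rfl⟩
  rintro n ⟨N, -, rfl⟩
  exact N.card_le_univ

/-- In a fractional matching, twice the size is at most `|N(A)| + |Aᶜ|` for every vertex set
`A`. -/
theorem two_mul_sum_le_card_neighbors_add_card_compl {V : Type*} [Fintype V] [DecidableEq V]
    (G : SimpleGraph V) [DecidableRel G.Adj] (x : Sym2 V → ℝ)
    (hx : ∀ e ∈ G.edgeSet, 0 ≤ x e)
    (hxdeg : ∀ v : V, ∑ e ∈ G.edgeFinset.filter (fun e => v ∈ e), x e ≤ 1) (A : Finset V) :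
    2 * ∑ e ∈ G.edgeFinset, x e ≤
      ((A.biUnion fun v => G.neighborFinset v).card : ℝ) + (Aᶜ.card : ℝ) := by
  have key : ∀ T : Finset V,
      ∑ e ∈ G.edgeFinset, ((T.filter (fun v => v ∈ e)).card : ℝ) * x e ≤ T.card := by
    intro T
    calc ∑ e ∈ G.edgeFinset, ((T.filter (fun v => v ∈ e)).card : ℝ) * x e
        = ∑ e ∈ G.edgeFinset, ∑ v ∈ T, if v ∈ e then x e else 0 := by
          refine Finset.sum_congr rfl fun e _ => ?_
          rw [← Finset.sum_filter, Finset.sum_const, nsmul_eq_mul]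
      _ = ∑ v ∈ T, ∑ e ∈ G.edgeFinset.filter (fun e => v ∈ e), x e := by
          rw [Finset.sum_comm]
          exact Finset.sum_congr rfl fun v _ => (Finset.sum_filter _ _).symm
      _ ≤ ∑ _v ∈ T, (1 : ℝ) := Finset.sum_le_sum fun v _ => hxdeg v
      _ = T.card := by simp
  refine le_trans ?_ (add_le_add (key _) (key _))
  rw [← Finset.sum_add_distrib, Finset.mul_sum]
  refine Finset.sum_le_sum fun e he => ?_
  rw [SimpleGraph.mem_edgeFinset] at he
  rw [← add_mul]
  refine mul_le_mul_of_nonneg_right ?_ (hx e he)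
  induction e using Sym2.ind with
  | _ a b =>
    have hab : G.Adj a b := he
    set N := A.biUnion fun v => G.neighborFinset v with hN
    have hcard : ∀ T : Finset V, (T.filter (fun v => v ∈ s(a, b))).card =
        (if a ∈ T then 1 else 0) + if b ∈ T then 1 else 0 := by
      intro T
      have : T.filter (fun v => v ∈ s(a, b)) = ({a, b} : Finset V).filter (fun v => v ∈ T) := by
        ext v
        simp [and_comm]
      rw [this, Finset.card_filter, Finset.sum_pair hab.ne]
    have ha : a ∈ A → b ∈ N := fun h => Finset.mem_biUnion.2 ⟨a, h, by simpa using hab⟩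
    have hb : b ∈ A → a ∈ N := fun h => Finset.mem_biUnion.2 ⟨b, h, by simpa using hab.symm⟩
    rw [hcard, hcard]
    norm_cast
    simp only [Finset.mem_compl]
    split_ifs <;> first | omega | tauto

/-- The size of any fractional matching `x` of a finite graph `G` is at most `3/2`
times the maximum size of an integral matching: `∑_{e∈E} x(e) ≤ (3/2)·ν(G)`. -/
theorem stmt_15 {V : Type*} [Fintype V] [DecidableEq V]
    (G : SimpleGraph V) [DecidableRel G.Adj] (x : Sym2 V → ℝ)
    (hx01 : ∀ e ∈ G.edgeSet, 0 ≤ x e ∧ x e ≤ 1)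
    (hxdeg : ∀ v : V, ∑ e ∈ G.edgeFinset.filter (fun e => v ∈ e), x e ≤ 1) :
    ∑ e ∈ G.edgeFinset, x e ≤ (3 / 2) * (maxMatchingSize G : ℝ) := by
  obtain ⟨A, -, hA⟩ := Finset.exists_max_image (Finset.univ : Finset (Finset V))
    (fun A => A.card - (A.biUnion fun v => G.neighborFinset v).card) ⟨∅, Finset.mem_univ _⟩
  set d := A.card - (A.biUnion fun v => G.neighborFinset v).card with hd
  obtain ⟨S, hSadj, hfst, hsnd, hScard⟩ := exists_partial_transversal_of_deficiency
    (fun v => G.neighborFinset v) d fun B => by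
      have := hA B (Finset.mem_univ _)
      omega
  obtain ⟨M, hM, -, hMcard⟩ := exists_isMatchingOn_card_le_three_mul G S
    (fun p hp => by simpa using hSadj p hp) hfst hsnd
  have hν := hM.card_le_maxMatchingSize
  have hbound : 2 * ∑ e ∈ G.edgeFinset, x e + d ≤ Fintype.card V := by
    have hx := fun e he => (hx01 e he).1
    rcases Nat.eq_zero_or_pos d with h0 | hpos
    · have := two_mul_sum_le_card_neighbors_add_card_compl G x hx hxdeg ∅
      simpa [h0] using this
    · have h1 := two_mul_sum_le_card_neighbors_add_card_compl G x hx hxdeg A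
      have h2 : (A.biUnion fun v => G.neighborFinset v).card + Aᶜ.card + d = Fintype.card V := by
        have := A.card_add_card_compl
        omega
      rw [← h2]
      push_cast
      linarith
  have hfin : Fintype.card V ≤ 3 * maxMatchingSize G + d := by omega
  have hfin' : (Fintype.card V : ℝ) ≤ 3 * maxMatchingSize G + d := by exact_mod_cast hfin
  linarith
end
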